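/- Let C be any real 2×n matrix and R a real symmetric positive definite 2×2 matrix. For all real symmetric positive definite n×n matrices Σ and Δ, the matrix S(Σ + Δ) − S(Σ) is symmetric positive definite. -/

import Mathlib

open Matrix

/-- The map `S(Σ) = Σ - Σ Cᵀ (C Σ Cᵀ + R)⁻¹ C Σ` of the paper. -/
noncomputable def Sfun {n : ℕ} (C : Matrix (Fin 2) (Fin n) ℝ)
    (R : Matrix (Fin 2) (Fin 2) ℝ) (S : Matrix (Fin n) (Fin n) ℝ) :
    Matrix (Fin n) (Fin n) ℝ :=
  S - S * Cᵀ * (C * S * Cᵀ + R)⁻¹ * (C * S)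

theorem aux_inv {n : ℕ} (X D : Matrix (Fin n) (Fin n) ℝ) (hX : X.PosDef) (hD : D.PosDef) :
    (X⁻¹ - (X + D)⁻¹).PosDef := by
  have h1 : (D⁻¹ + X⁻¹).PosDef := hD.inv.add hX.inv
  have h := add_mul_mul_inv_eq_sub X 1 D 1 hX.isUnit hD.isUnit (by simpa using h1.isUnit)
  simp only [Matrix.mul_one, Matrix.one_mul] at h
  rw [h, sub_sub_cancel]
  have h2 := (Matrix.IsUnit.posDef_star_right_conjugate_iff (x := (D⁻¹ + X⁻¹)⁻¹)
    hX.inv.isUnit).2 h1.inv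
  rwa [star_eq_conjTranspose, hX.inv.isHermitian.eq] at h2

theorem aux_S {n : ℕ} (C : Matrix (Fin 2) (Fin n) ℝ)
    (R : Matrix (Fin 2) (Fin 2) ℝ) (hR : R.PosDef) (S : Matrix (Fin n) (Fin n) ℝ)
    (hS : S.PosDef) : Sfun C R S = (S⁻¹ + Cᵀ * R⁻¹ * C)⁻¹ := by
  have hi : S⁻¹⁻¹ = S := nonsing_inv_nonsing_inv S ((isUnit_iff_isUnit_det S).1 hS.isUnit)
  have hr : R⁻¹⁻¹ = R := nonsing_inv_nonsing_inv R ((isUnit_iff_isUnit_det R).1 hR.isUnit)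
  have h1 : (R + C * S * Cᵀ).PosDef := by
    have := hS.posSemidef.mul_mul_conjTranspose_same C
    rw [conjTranspose_eq_transpose_of_trivial] at this
    exact hR.add_posSemidef this
  have h := add_mul_mul_inv_eq_sub S⁻¹ Cᵀ R⁻¹ C hS.inv.isUnit hR.inv.isUnit
    (by rw [hi, hr]; exact h1.isUnit)
  rw [h, hi, hr, Sfun, add_comm R]
  simp only [Matrix.mul_assoc]

/-- Let `C` be any real `2 × n` matrix and `R` a real symmetric positive
definite `2 × 2` matrix.  For all symmetric positive definite `n × n` matrices `Σ` and `Δ`,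
the matrix `S(Σ + Δ) - S(Σ)` is symmetric positive definite. -/
theorem stmt_5 {n : ℕ} (C : Matrix (Fin 2) (Fin n) ℝ)
    (R : Matrix (Fin 2) (Fin 2) ℝ) (hR : R.PosDef) :
    ∀ S Δ : Matrix (Fin n) (Fin n) ℝ, S.PosDef → Δ.PosDef →
      (Sfun C R (S + Δ) - Sfun C R S).PosDef := by
  intro S Δ hS hD
  have hK : (Cᵀ * R⁻¹ * C).PosSemidef := by
    have := hR.inv.posSemidef.conjTranspose_mul_mul_same C
    rwa [conjTranspose_eq_transpose_of_trivial] at this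
  rw [aux_S C R hR S hS, aux_S C R hR _ (hS.add hD)]
  have h := aux_inv _ _ ((hS.add hD).inv.add_posSemidef hK) (aux_inv S Δ hS hD)
  convert h using 3
  abel
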